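/- arXiv:1509.00527 — 8 statements merged into one kernel-verified Lean document; each statement's English description precedes it below -/
import Mathlib

section
/- Let a, b, c, f, ρ be positive real numbers. Then the supremum over v > 0 of the function v ↦ ρ·v / (a·(v−b)² + c + f) equals ρ·√(a·b² + c + f) / (√a · [ (√(a·b² + c + f) − √a · b)² + c + f ]), and this supremum is attained at v = √((a·b² + c + f)/a). -/
/-- The supremum over `v > 0` of `v ↦ ρ v / (a (v-b)² + c + f)` equals
`M₀ = ρ √(a b² + c + f) / (√a ((√(a b² + c + f) - √a b)² + c + f))`, and it is attained
at `v = √((a b² + c + f)/a)`. -/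
theorem stmt_0 (a b c f ρ : ℝ) (ha : 0 < a) (hb : 0 < b) (hc : 0 < c)
    (hf : 0 < f) (hρ : 0 < ρ) :
    IsGreatest ((fun v : ℝ => ρ * v / (a * (v - b) ^ 2 + c + f)) '' Set.Ioi 0)
      (ρ * Real.sqrt (a * b ^ 2 + c + f) /
        (Real.sqrt a * ((Real.sqrt (a * b ^ 2 + c + f) - Real.sqrt a * b) ^ 2 + c + f))) ∧
    Real.sqrt ((a * b ^ 2 + c + f) / a) ∈ Set.Ioi (0 : ℝ) ∧
    ρ * Real.sqrt ((a * b ^ 2 + c + f) / a) /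
        (a * (Real.sqrt ((a * b ^ 2 + c + f) / a) - b) ^ 2 + c + f) =
      ρ * Real.sqrt (a * b ^ 2 + c + f) /
        (Real.sqrt a * ((Real.sqrt (a * b ^ 2 + c + f) - Real.sqrt a * b) ^ 2 + c + f)) := by
  have hd : 0 < a * b ^ 2 + c + f := by positivity
  have hs : 0 < √a := Real.sqrt_pos.2 ha
  have hS : 0 < √(a * b ^ 2 + c + f) := Real.sqrt_pos.2 hd
  have hs2 : √a ^ 2 = a := Real.sq_sqrt ha.le
  have hS2 : √(a * b ^ 2 + c + f) ^ 2 = a * b ^ 2 + c + f := Real.sq_sqrt hd.le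
  rw [Real.sqrt_div hd.le]
  generalize √(a * b ^ 2 + c + f) = S at *
  generalize √a = s at *
  subst hs2
  have hmem : S / s ∈ Set.Ioi (0 : ℝ) := div_pos hS hs
  have hval : ρ * (S / s) / (s ^ 2 * (S / s - b) ^ 2 + c + f) =
      ρ * S / (s * ((S - s * b) ^ 2 + c + f)) := by
    have h : s ^ 2 * (S / s - b) ^ 2 = (S - s * b) ^ 2 := by
      field_simp
    rw [h, ← mul_div_assoc, div_div]
  refine ⟨⟨⟨S / s, hmem, hval⟩, ?_⟩, hmem, hval⟩
  rintro _ ⟨v, -, rfl⟩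
  have h : ρ * S * (s ^ 2 * (v - b) ^ 2 + c + f) -
      ρ * v * (s * ((S - s * b) ^ 2 + c + f)) = ρ * S * (s * v - S) ^ 2 := by
    linear_combination (ρ * v * s - ρ * S) * hS2
  have h_nonneg : 0 ≤ ρ * S * (s * v - S) ^ 2 := by positivity
  exact (div_le_div_iff₀ (by positivity) (by positivity)).2 (by linarith)
end

section
/- Let a, b, c, f, ρ be positive real numbers and let M₀ = ρ·√(a·b²+c+f) / (√a·[(√(a·b²+c+f) − √a·b)² + c + f]). Let v : [0,∞) → ℝ be a continuous nonnegative function, let u₀ ≥ 0, and let u : [0,∞) → ℝ satisfy u(0) = u₀ and, for every t ≥ 0, u′(t) = ρ·v(t) − (a·(v(t)−b)² + c + f)·u(t). Then u(t) ≤ max{u₀, M₀} for all t ≥ 0. -/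
/-- A trajectory of a linear damped equation with source `g` and damping `d > 0` stays below any
level `K` that bounds the initial value and satisfies `g ≤ K * d`. -/
theorem le_of_hasDerivWithinAt_of_le_mul {u g d : ℝ → ℝ} {K : ℝ} (hu : u 0 ≤ K)
    (hd : ∀ t, 0 ≤ t → 0 < d t) (hg : ∀ t, 0 ≤ t → g t ≤ K * d t)
    (hderiv : ∀ t, 0 ≤ t → HasDerivWithinAt u (g t - d t * u t) (Set.Ici 0) t)
    {t : ℝ} (ht : 0 ≤ t) : u t ≤ K := by
  refine le_of_forall_pos_le_add fun ε hε => ?_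
  refine image_le_of_deriv_right_lt_deriv_boundary (a := 0) (b := t)
    (f' := fun s => g s - d s * u s) (B := fun _ => K + ε) (B' := fun _ => 0)
    (fun s hs => ((hderiv s hs.1).continuousWithinAt).mono Set.Icc_subset_Ici_self)
    (fun s hs => (hderiv s hs.1).mono (Set.Ici_subset_Ici.2 hs.1))
    (by linarith) (fun s => hasDerivAt_const s _) (fun s hs h => ?_) ⟨ht, le_rfl⟩
  have hpos := mul_pos (hd s hs.1) hε
  have hle := hg s hs.1
  simp only [h]
  linarith

/-- The explicit constant bounds the quotient `ρ x / (a (x - b)² + c + f)`. -/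
theorem mul_le_sqrt_div_mul {a b c f ρ : ℝ} (ha : 0 < a) (hc : 0 < c) (hf : 0 < f)
    (hρ : 0 < ρ) (x : ℝ) :
    ρ * x ≤ ρ * Real.sqrt (a * b ^ 2 + c + f) /
      (Real.sqrt a * ((Real.sqrt (a * b ^ 2 + c + f) - Real.sqrt a * b) ^ 2 + c + f)) *
      (a * (x - b) ^ 2 + c + f) := by
  have hS : Real.sqrt (a * b ^ 2 + c + f) ^ 2 = a * b ^ 2 + c + f :=
    Real.sq_sqrt (by positivity)
  have hS0 := Real.sqrt_nonneg (a * b ^ 2 + c + f)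
  have hs : Real.sqrt a ^ 2 = a := Real.sq_sqrt ha.le
  have hs0 : 0 < Real.sqrt a := Real.sqrt_pos.2 ha
  generalize Real.sqrt (a * b ^ 2 + c + f) = S at *
  generalize Real.sqrt a = s at *
  subst hs
  have hcf : c = S ^ 2 - s ^ 2 * b ^ 2 - f := by linarith
  rw [div_mul_eq_mul_div, le_div_iff₀ (by positivity)]
  have key : 0 ≤ ρ * (S * (s * x - S) ^ 2) := by positivity
  subst hcf
  linarith


/-- if `u' = ρ v - (a(v-b)² + c + f) u` on `[0,∞)` with `v` continuous and
nonnegative and `u(0) = u₀ ≥ 0`, then `u(t) ≤ max{u₀, M₀}` for all `t ≥ 0`. -/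
theorem stmt_2 (a b c f ρ : ℝ) (ha : 0 < a) (hb : 0 < b) (hc : 0 < c)
    (hf : 0 < f) (hρ : 0 < ρ)
    (M₀ : ℝ)
    (hM₀ : M₀ = ρ * Real.sqrt (a * b ^ 2 + c + f) /
      (Real.sqrt a * ((Real.sqrt (a * b ^ 2 + c + f) - Real.sqrt a * b) ^ 2 + c + f)))
    (v u : ℝ → ℝ) (hvcont : ContinuousOn v (Set.Ici 0))
    (hvnonneg : ∀ t, 0 ≤ t → 0 ≤ v t)
    (u₀ : ℝ) (hu₀ : 0 ≤ u₀) (hinit : u 0 = u₀)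
    (hderiv : ∀ t, 0 ≤ t →
      HasDerivWithinAt u (ρ * v t - (a * (v t - b) ^ 2 + c + f) * u t) (Set.Ici 0) t) :
    ∀ t, 0 ≤ t → u t ≤ max u₀ M₀ := by
  intro t ht
  refine le_of_hasDerivWithinAt_of_le_mul (hinit.trans_le (le_max_left _ _))
    (fun s _ => by positivity) (fun s _ => ?_) hderiv ht
  refine (mul_le_sqrt_div_mul (b := b) ha hc hf hρ (v s)).trans ?_
  rw [← hM₀]
  exact mul_le_mul_of_nonneg_right (le_max_right _ _) (by positivity)
end

section
/- Let a, b, c, f, ρ be positive real numbers and let M₀ = ρ·√(a·b²+c+f) / (√a·[(√(a·b²+c+f) − √a·b)² + c + f]). Let v : [0,∞) → ℝ be a continuous nonnegative function, let u₀ ≥ 0, and let u : [0,∞) → ℝ satisfy u(0) = u₀ and, for every t ≥ 0, u′(t) = ρ·v(t) − (a·(v(t)−b)² + c + f)·u(t). Then for all t ≥ 0, u(t) ≤ M₀ − (M₀ − u₀)·exp(−∫₀ᵗ (a·(v(s)−b)² + c + f) ds). -/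
open Set in
/-- Grönwall-type comparison: if `u' ≤ q (M - u)` on `[0, ∞)` with `q` continuous, then
`u t ≤ M - (M - u 0) exp (-∫₀ᵗ q)`. -/
theorem le_sub_mul_exp_neg_integral {u u' q : ℝ → ℝ} {M : ℝ} (hq : ContinuousOn q (Ici 0))
    (hu : ∀ t, 0 ≤ t → HasDerivWithinAt u (u' t) (Ici 0) t)
    (hle : ∀ t, 0 ≤ t → u' t ≤ q t * (M - u t)) {t : ℝ} (ht : 0 ≤ t) :
    u t ≤ M - (M - u 0) * Real.exp (-∫ s in (0 : ℝ)..t, q s) := by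
  set p : ℝ → ℝ := fun s => q (max s 0)
  have hp : Continuous p :=
    hq.comp_continuous (continuous_id.max continuous_const) fun s => le_max_right s 0
  have hpq : ∀ s, 0 ≤ s → p s = q s := fun s hs => by simp only [p, max_eq_left hs]
  have hint : ∫ s in (0 : ℝ)..t, q s = ∫ s in (0 : ℝ)..t, p s := by
    refine intervalIntegral.integral_congr fun s hs => (hpq s ?_).symm
    rw [uIcc_of_le ht] at hs
    exact hs.1
  rw [hint]
  set Q : ℝ → ℝ := fun x => ∫ s in (0 : ℝ)..x, p s with hQ
  have hQd : ∀ x, HasDerivAt Q (p x) x := fun x => hp.integral_hasStrictDerivAt 0 x |>.hasDerivAt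
  have hd : ∀ x, 0 ≤ x → HasDerivWithinAt (fun y => (u y - M) * Real.exp (Q y))
      (u' x * Real.exp (Q x) + (u x - M) * (Real.exp (Q x) * p x)) (Ici 0) x := fun x hx =>
    ((hu x hx).sub_const M).mul (hQd x).exp.hasDerivWithinAt
  have hanti : AntitoneOn (fun y => (u y - M) * Real.exp (Q y)) (Ici 0) := by
    refine antitoneOn_of_hasDerivWithinAt_nonpos (convex_Ici 0)
      (fun x hx => (hd x hx).continuousWithinAt)
      (fun x hx => (hd x (interior_subset hx)).mono interior_subset) fun x hx => ?_
    have hx0 : 0 ≤ x := interior_subset hx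
    have h := hle x hx0
    rw [hpq x hx0]
    have := mul_nonneg (Real.exp_pos (Q x)).le (sub_nonneg.2 h)
    linarith
  have h := hanti self_mem_Ici ht ht
  have hQ0 : Q 0 = 0 := by simp [hQ]
  simp only [hQ0, Real.exp_zero, mul_one] at h
  have h2 := mul_le_mul_of_nonneg_right h (Real.exp_pos (-Q t)).le
  rw [mul_assoc, ← Real.exp_add, add_neg_cancel, Real.exp_zero, mul_one] at h2
  linarith

/-- The rational function `v ↦ ρ v / (a (v - b)² + k)` is bounded by its value at
`v = √(a b² + k) / √a`. -/
theorem mul_le_max_mul_quadratic {a b k ρ : ℝ} (ha : 0 < a) (hk : 0 < k) (hρ : 0 ≤ ρ) (v : ℝ) :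
    ρ * v ≤ ρ * √(a * b ^ 2 + k) / (√a * ((√(a * b ^ 2 + k) - √a * b) ^ 2 + k)) *
      (a * (v - b) ^ 2 + k) := by
  have hS : 0 < √(a * b ^ 2 + k) := Real.sqrt_pos.2 (by positivity)
  have hS2 : √(a * b ^ 2 + k) ^ 2 = a * b ^ 2 + k := Real.sq_sqrt (by positivity)
  have hr : 0 < √a := Real.sqrt_pos.2 ha
  have hr2 : √a ^ 2 = a := Real.sq_sqrt ha.le
  generalize √(a * b ^ 2 + k) = S at *
  generalize √a = r at *
  subst hr2
  obtain rfl : k = S ^ 2 - r ^ 2 * b ^ 2 := by linarith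
  rw [div_mul_eq_mul_div, le_div_iff₀ (by positivity)]
  have h := mul_nonneg (mul_nonneg hρ hS.le) (sq_nonneg (r * v - S))
  linarith

/-- under the same hypotheses as Statement 2,
`u(t) ≤ M₀ - (M₀ - u₀) exp(-∫₀ᵗ (a(v(s)-b)² + c + f) ds)` for all `t ≥ 0`. -/
theorem stmt_3 (a b c f ρ : ℝ) (ha : 0 < a) (hb : 0 < b) (hc : 0 < c)
    (hf : 0 < f) (hρ : 0 < ρ)
    (M₀ : ℝ)
    (hM₀ : M₀ = ρ * Real.sqrt (a * b ^ 2 + c + f) /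
      (Real.sqrt a * ((Real.sqrt (a * b ^ 2 + c + f) - Real.sqrt a * b) ^ 2 + c + f)))
    (v u : ℝ → ℝ) (hvcont : ContinuousOn v (Set.Ici 0))
    (hvnonneg : ∀ t, 0 ≤ t → 0 ≤ v t)
    (u₀ : ℝ) (hu₀ : 0 ≤ u₀) (hinit : u 0 = u₀)
    (hderiv : ∀ t, 0 ≤ t →
      HasDerivWithinAt u (ρ * v t - (a * (v t - b) ^ 2 + c + f) * u t) (Set.Ici 0) t) :
    ∀ t, 0 ≤ t →
      u t ≤ M₀ - (M₀ - u₀) *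
        Real.exp (-∫ s in (0:ℝ)..t, (a * (v s - b) ^ 2 + c + f)) := by
  intro t ht
  rw [← hinit]
  refine le_sub_mul_exp_neg_integral (by fun_prop) hderiv (fun s _ => ?_) ht
  have h := mul_le_max_mul_quadratic (b := b) ha (add_pos hc hf) hρ.le (v s)
  simp only [← add_assoc] at h
  rw [← hM₀] at h
  linarith
end

section
/- Let a, b, c, f, ρ be positive real numbers and let M₀ = ρ·√(a·b²+c+f) / (√a·[(√(a·b²+c+f) − √a·b)² + c + f]). Let v : [0,∞) → ℝ be a continuous nonnegative function, let u₀ ≥ 0, and let u : [0,∞) → ℝ satisfy u(0) = u₀ and, for every t ≥ 0, u′(t) = ρ·v(t) − (a·(v(t)−b)² + c + f)·u(t). Then limsup of u(t) as t → ∞ is at most M₀. -/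
/-- A function which decays at rate at least `r` wherever it is positive is bounded by a decaying
exponential. -/
lemma le_exp_of_deriv_le_neg_mul {r : ℝ} (hr : 0 < r) {f f' : ℝ → ℝ}
    (hf : ∀ t, 0 ≤ t → HasDerivWithinAt f (f' t) (Set.Ici 0) t)
    (hf' : ∀ t, 0 ≤ t → 0 < f t → f' t ≤ -r * f t) {t : ℝ} (ht : 0 ≤ t) :
    f t ≤ (|f 0| + 1) * Real.exp (-(r / 2) * t) := by
  have hB : ∀ x : ℝ, HasDerivAt (fun x => (|f 0| + 1) * Real.exp (-(r / 2) * x))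
      (-(r / 2) * ((|f 0| + 1) * Real.exp (-(r / 2) * x))) x := by
    intro x
    have h := (((hasDerivAt_id' x).const_mul (-(r / 2))).exp).const_mul (|f 0| + 1)
    exact h.congr_deriv (by ring)
  refine image_le_of_deriv_right_lt_deriv_boundary (a := 0) (b := t) (f' := f')
    (fun x hx => ((hf x hx.1).continuousWithinAt).mono Set.Icc_subset_Ici_self)
    (fun x hx => (hf x hx.1).mono (Set.Ici_subset_Ici.2 hx.1)) ?_ hB ?_ ⟨ht, le_rfl⟩
  · simp only [mul_zero, Real.exp_zero, mul_one]
    linarith [le_abs_self (f 0)]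
  · intro x hx hfx
    have hpos : 0 < f x := by rw [hfx]; positivity
    have h := hf' x hx.1 hpos
    rw [← hfx]
    nlinarith

/-- The explicit constant is an upper bound for `ρ * x / (a * (x - b) ^ 2 + k)`. -/
lemma mul_le_sqrt_quotient_mul {a b k ρ : ℝ} (ha : 0 < a) (hk : 0 < k) (hρ : 0 < ρ) (x : ℝ) :
    ρ * x ≤ ρ * √(a * b ^ 2 + k) / (√a * ((√(a * b ^ 2 + k) - √a * b) ^ 2 + k)) *
      (a * (x - b) ^ 2 + k) := by
  have hS : 0 < √(a * b ^ 2 + k) := Real.sqrt_pos.2 (by positivity)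
  have hq : 0 < √a := Real.sqrt_pos.2 ha
  have hS2 : √(a * b ^ 2 + k) ^ 2 = a * b ^ 2 + k := Real.sq_sqrt (by positivity)
  have hq2 : √a ^ 2 = a := Real.sq_sqrt ha.le
  set S := √(a * b ^ 2 + k)
  set q := √a
  rw [div_mul_eq_mul_div, le_div_iff₀ (by positivity)]
  have key : ρ * S * (a * (x - b) ^ 2 + k) - ρ * x * (q * ((S - q * b) ^ 2 + k))
      = ρ * S * (q * x - S) ^ 2 := by
    have hk' : k = S ^ 2 - q ^ 2 * b ^ 2 := by rw [hS2, hq2]; ring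
    rw [hk', ← hq2]
    ring
  have : 0 ≤ ρ * S * (q * x - S) ^ 2 := by positivity
  linarith

/-- under the same hypotheses as Statement 2,
`limsup_{t→∞} u(t) ≤ M₀`. -/
theorem stmt_4 (a b c f ρ : ℝ) (ha : 0 < a) (hb : 0 < b) (hc : 0 < c)
    (hf : 0 < f) (hρ : 0 < ρ)
    (M₀ : ℝ)
    (hM₀ : M₀ = ρ * Real.sqrt (a * b ^ 2 + c + f) /
      (Real.sqrt a * ((Real.sqrt (a * b ^ 2 + c + f) - Real.sqrt a * b) ^ 2 + c + f)))
    (v u : ℝ → ℝ) (hvcont : ContinuousOn v (Set.Ici 0))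
    (hvnonneg : ∀ t, 0 ≤ t → 0 ≤ v t)
    (u₀ : ℝ) (hu₀ : 0 ≤ u₀) (hinit : u 0 = u₀)
    (hderiv : ∀ t, 0 ≤ t →
      HasDerivWithinAt u (ρ * v t - (a * (v t - b) ^ 2 + c + f) * u t) (Set.Ici 0) t) :
    Filter.limsup u Filter.atTop ≤ M₀ := by
  have hk : 0 < c + f := by positivity
  have hM : ∀ x, ρ * x ≤ M₀ * (a * (x - b) ^ 2 + (c + f)) := by
    intro x
    rw [hM₀, add_assoc, add_assoc]
    exact mul_le_sqrt_quotient_mul ha hk hρ x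
  have hg : ∀ x, 0 ≤ a * (x - b) ^ 2 := fun x => by positivity
  have upper : ∀ t, 0 ≤ t →
      u t - M₀ ≤ (|u 0 - M₀| + 1) * Real.exp (-((c + f) / 2) * t) := fun t ht =>
    le_exp_of_deriv_le_neg_mul hk (f := fun t => u t - M₀)
      (fun t ht => (hderiv t ht).sub_const M₀)
      (fun t _ hpos => by nlinarith [hM (v t), mul_nonneg (hg (v t)) hpos.le]) ht
  have lower : ∀ t, 0 ≤ t → -u t ≤ (|-u 0| + 1) * Real.exp (-((c + f) / 2) * t) := fun t ht =>
    le_exp_of_deriv_le_neg_mul hk (f := fun t => -u t)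
      (fun t ht => (hderiv t ht).neg)
      (fun t ht hpos => by
        nlinarith [mul_nonneg hρ.le (hvnonneg t ht), mul_nonneg (hg (v t)) hpos.le]) ht
  have hlim : ∀ C : ℝ, Filter.Tendsto (fun t => C * Real.exp (-((c + f) / 2) * t))
      Filter.atTop (nhds 0) := by
    intro C
    have h : Filter.Tendsto (fun t : ℝ => -((c + f) / 2) * t) Filter.atTop Filter.atBot :=
      Filter.tendsto_id.const_mul_atTop_of_neg (by linarith)
    simpa using (Real.tendsto_exp_atBot.comp h).const_mul C
  have hcobdd : Filter.IsCoboundedUnder (· ≤ ·) Filter.atTop u := by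
    refine Filter.IsBoundedUnder.isCoboundedUnder_le ⟨-1, ?_⟩
    rw [Filter.eventually_map]
    filter_upwards [(hlim (|-u 0| + 1)).eventually_lt_const one_pos,
      Filter.eventually_ge_atTop 0] with t h1 ht
    change -1 ≤ u t
    linarith [lower t ht]
  refine le_of_forall_pos_le_add fun ε hε => Filter.limsup_le_of_le hcobdd ?_
  filter_upwards [(hlim (|u 0 - M₀| + 1)).eventually_lt_const hε,
    Filter.eventually_ge_atTop 0] with t h1 ht
  linarith [upper t ht]
end

section
/- Let a, b, c, f, h, ρ, σ, κ be positive real numbers satisfying (a·b² + c + f)/f < κ < ρ/h and σ² < 2·(ρ − κ·h)/κ. Then there exists ε > 0 such that for all u > 0 and v > 0: ((κ·f − c − f − a·b²)·u + (ρ − κ·h)·v)/(u + κ·v) − σ²·κ²·v²/(2·(u + κ·v)²) ≥ ε/2. -/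
/-- if `(ab²+c+f)/f < κ < ρ/h` and `σ² < 2(ρ - κh)/κ`, then there exists
`ε > 0` such that for all `u, v > 0`,
`((κf - c - f - ab²)u + (ρ - κh)v)/(u + κv) - σ²κ²v²/(2(u + κv)²) ≥ ε/2`. -/
theorem stmt_6 (a b c f h ρ σ κ : ℝ) (ha : 0 < a) (hb : 0 < b) (hc : 0 < c)
    (hf : 0 < f) (hh : 0 < h) (hρ : 0 < ρ) (hσ : 0 < σ) (hκ : 0 < κ)
    (h1 : (a * b ^ 2 + c + f) / f < κ) (h2 : κ < ρ / h)
    (h3 : σ ^ 2 < 2 * (ρ - κ * h) / κ) :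
    ∃ ε : ℝ, 0 < ε ∧ ∀ u v : ℝ, 0 < u → 0 < v →
      ε / 2 ≤ ((κ * f - c - f - a * b ^ 2) * u + (ρ - κ * h) * v) / (u + κ * v)
        - σ ^ 2 * κ ^ 2 * v ^ 2 / (2 * (u + κ * v) ^ 2) := by
  have hA : 0 < κ * f - c - f - a * b ^ 2 := by
    rw [div_lt_iff₀ hf] at h1
    linarith
  have hD : 0 < (ρ - κ * h) / κ - σ ^ 2 / 2 := by
    rw [mul_div_assoc] at h3
    linarith
  obtain ⟨D, hD'⟩ : ∃ D, D = (ρ - κ * h) / κ - σ ^ 2 / 2 := ⟨_, rfl⟩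
  have hB : ρ - κ * h = κ * (D + σ ^ 2 / 2) := by
    rw [hD']
    field_simp
    ring
  rw [← hD'] at hD
  rw [hB]
  generalize κ * f - c - f - a * b ^ 2 = A at hA ⊢
  refine ⟨2 * min A D, by positivity, fun u v hu hv => ?_⟩
  have hS : 0 < u + κ * v := by positivity
  have hmin : min A D * (u + κ * v) ≤ A * u + D * (κ * v) := by
    rw [mul_add]
    gcongr
    · exact min_le_left A D
    · exact min_le_right A D
  have hsplit : (A * u + κ * (D + σ ^ 2 / 2) * v) / (u + κ * v)
        - σ ^ 2 * κ ^ 2 * v ^ 2 / (2 * (u + κ * v) ^ 2)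
      = (A * u + D * (κ * v)) / (u + κ * v)
        + σ ^ 2 * κ * v * u / (2 * (u + κ * v) ^ 2) := by
    field_simp
    ring
  have hmain : min A D ≤ (A * u + D * (κ * v)) / (u + κ * v) := (le_div_iff₀ hS).2 hmin
  have hrest : 0 ≤ σ ^ 2 * κ * v * u / (2 * (u + κ * v) ^ 2) := by positivity
  rw [hsplit]
  linarith
end

section
/- Let c, f, h, ρ, σ be positive real numbers, let F₁(x) = f²·x⁴ + 2·f·(σ² + h − c − f)·x³ + ((c+f−h)² − 2·ρ·f − 2·(c+f)·σ²)·x² + 2·ρ·(c+f−h)·x + ρ², and for κ, ε > 0 define F_{κ,ε}(u,v) = (2·(c + f − κ·f) − ε)·u² − 2·(κ·(κ·f − c − f) + ρ − κ·h + κ·ε)·u·v + (σ²·κ² + 2·κ·(κ·h − ρ) − κ²·ε)·v². If 0 < κ < (c+f)/f and F₁(κ) < 0, then there exists ε > 0 such that F_{κ,ε}(u,v) ≥ 0 for all u ≥ 0 and v ≥ 0. -/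
/-- A positive definite binary quadratic form dominates a positive multiple of the square of any
linear form `u + κ v`. -/
theorem exists_pos_mul_sq_le_of_discrim_pos {a b c : ℝ} (ha : 0 < a) (hD : b ^ 2 < a * c) (κ : ℝ) :
    ∃ ε : ℝ, 0 < ε ∧ ∀ u v : ℝ,
      ε * (u + κ * v) ^ 2 ≤ a * u ^ 2 - 2 * b * u * v + c * v ^ 2 := by
  have hc : 0 < c := pos_of_mul_pos_right ((sq_nonneg b).trans_lt hD) ha.le
  have hM : 0 < 2 * c + 2 * κ ^ 2 * a := by positivity
  refine ⟨(a * c - b ^ 2) / (2 * c + 2 * κ ^ 2 * a), div_pos (sub_pos.2 hD) hM, fun u v ↦ ?_⟩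
  rw [div_mul_eq_mul_div, div_le_iff₀ hM]
  have h₁ := mul_nonneg (sub_nonneg.2 hD.le) (sq_nonneg (u - κ * v))
  have h₂ := sq_nonneg (c * v - b * u)
  have h₃ := mul_nonneg (sq_nonneg κ) (sq_nonneg (a * u - b * v))
  linear_combination h₁ + 2 * h₂ + 2 * h₃

/-- if `0 < κ < (c+f)/f` and `F₁(κ) < 0`, then for some `ε > 0` the
quadratic form `F_{κ,ε}` is nonnegative on the closed positive quadrant. -/
theorem stmt_14 (c f h ρ σ : ℝ) (hc : 0 < c) (hf : 0 < f) (hh : 0 < h)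
    (hρ : 0 < ρ) (hσ : 0 < σ)
    (F₁ : ℝ → ℝ)
    (hF₁ : ∀ x, F₁ x = f ^ 2 * x ^ 4 + 2 * f * (σ ^ 2 + h - c - f) * x ^ 3
      + ((c + f - h) ^ 2 - 2 * ρ * f - 2 * (c + f) * σ ^ 2) * x ^ 2
      + 2 * ρ * (c + f - h) * x + ρ ^ 2)
    (F : ℝ → ℝ → ℝ → ℝ → ℝ)
    (hF : ∀ κ ε u v, F κ ε u v = (2 * (c + f - κ * f) - ε) * u ^ 2
      - 2 * (κ * (κ * f - c - f) + ρ - κ * h + κ * ε) * u * v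
      + (σ ^ 2 * κ ^ 2 + 2 * κ * (κ * h - ρ) - κ ^ 2 * ε) * v ^ 2)
    (κ : ℝ) (hκ0 : 0 < κ) (hκ1 : κ < (c + f) / f) (hneg : F₁ κ < 0) :
    ∃ ε : ℝ, 0 < ε ∧ ∀ u v : ℝ, 0 ≤ u → 0 ≤ v → 0 ≤ F κ ε u v := by
  have ha : 0 < 2 * (c + f - κ * f) := by
    have := (lt_div_iff₀ hf).1 hκ1
    linarith
  have hD : (κ * (κ * f - c - f) + ρ - κ * h) ^ 2 <
      2 * (c + f - κ * f) * (σ ^ 2 * κ ^ 2 + 2 * κ * (κ * h - ρ)) := by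
    rw [hF₁] at hneg
    linear_combination hneg
  obtain ⟨ε, hε, hle⟩ := exists_pos_mul_sq_le_of_discrim_pos ha hD κ
  refine ⟨ε, hε, fun u v _ _ ↦ ?_⟩
  rw [hF]
  linear_combination hle u v
end

section
/- Let c, f, h, ρ, σ be positive real numbers, let F₂(x) = f·x² − (c+f+h)·x + ρ, and for κ, ε > 0 define F_{κ,ε}(u,v) = (2·(c + f − κ·f) − ε)·u² − 2·(κ·(κ·f − c − f) + ρ − κ·h + κ·ε)·u·v + (σ²·κ² + 2·κ·(κ·h − ρ) − κ²·ε)·v². If 2·ρ/(σ² + 2·h) < κ < (c+f)/f and F₂(κ) < 0, then there exists ε > 0 such that F_{κ,ε}(u,v) ≥ 0 for all u ≥ 0 and v ≥ 0. -/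
/-- if `2ρ/(σ²+2h) < κ < (c+f)/f` and `F₂(κ) < 0`, then for some `ε > 0`
the quadratic form `F_{κ,ε}` is nonnegative on the closed positive quadrant. -/
theorem stmt_15 (c f h ρ σ : ℝ) (hc : 0 < c) (hf : 0 < f) (hh : 0 < h)
    (hρ : 0 < ρ) (hσ : 0 < σ)
    (F₂ : ℝ → ℝ)
    (hF₂ : ∀ x, F₂ x = f * x ^ 2 - (c + f + h) * x + ρ)
    (F : ℝ → ℝ → ℝ → ℝ → ℝ)
    (hF : ∀ κ ε u v, F κ ε u v = (2 * (c + f - κ * f) - ε) * u ^ 2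
      - 2 * (κ * (κ * f - c - f) + ρ - κ * h + κ * ε) * u * v
      + (σ ^ 2 * κ ^ 2 + 2 * κ * (κ * h - ρ) - κ ^ 2 * ε) * v ^ 2)
    (κ : ℝ) (hκ0 : 2 * ρ / (σ ^ 2 + 2 * h) < κ) (hκ1 : κ < (c + f) / f)
    (hneg : F₂ κ < 0) :
    ∃ ε : ℝ, 0 < ε ∧ ∀ u v : ℝ, 0 ≤ u → 0 ≤ v → 0 ≤ F κ ε u v := by
  have hκ : 0 < κ := lt_trans (by positivity) hκ0
  have hA : 0 < 2 * (c + f - κ * f) := by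
    have := (lt_div_iff₀ hf).1 hκ1
    linarith
  have hB : 0 < σ ^ 2 * κ ^ 2 + 2 * κ * (κ * h - ρ) := by
    have h₁ := (div_lt_iff₀ (by positivity)).1 hκ0
    have h₂ := mul_pos hκ (sub_pos.2 h₁)
    linarith
  rw [hF₂] at hneg
  have hC : 0 < -(κ * (κ * f - c - f) + ρ - κ * h) := by linarith
  obtain ⟨ε, hε, hεm⟩ := exists_between (lt_min hA (lt_min (div_pos hC hκ)
    (div_pos hB (pow_pos hκ 2))))
  obtain ⟨hεA, hεm⟩ := lt_min_iff.1 hεm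
  obtain ⟨hεC, hεB⟩ := lt_min_iff.1 hεm
  rw [lt_div_iff₀ hκ] at hεC
  rw [lt_div_iff₀ (pow_pos hκ 2)] at hεB
  refine ⟨ε, hε, fun u v hu hv => ?_⟩
  rw [hF]
  have h₁ := mul_nonneg (sub_pos.2 hεA).le (sq_nonneg u)
  have h₂ := mul_nonneg (sub_pos.2 hεC).le (mul_nonneg hu hv)
  have h₃ := mul_nonneg (sub_pos.2 hεB).le (sq_nonneg v)
  linarith
end

section
/- Let a, b, c, f, h, ρ, σ be positive real numbers. Define V(u,v) = u² + v² − log u − log v and G(u,v) = 2·(ρ + f)·u·v − 2·(a·(v−b)² + c + f)·u² + (σ² − 2·h)·v² + a·(v−b)² + c − ρ·v/u − f·u/v + f + h + σ²/2. Then there exist positive constants M₁ and M₂ such that G(u,v) < M₁·V(u,v) + M₂ for all u > 0 and v > 0. -/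
/-- the generator of the stochastic forest model applied to the Lyapunov
function `V(u,v) = u² + v² - log u - log v` satisfies a linear growth bound
`G < M₁ V + M₂` on the open positive quadrant. -/
theorem stmt_17 (a b c f h ρ σ : ℝ) (ha : 0 < a) (hb : 0 < b) (hc : 0 < c)
    (hf : 0 < f) (hh : 0 < h) (hρ : 0 < ρ) (hσ : 0 < σ)
    (V G : ℝ → ℝ → ℝ)
    (hV : ∀ u v, V u v = u ^ 2 + v ^ 2 - Real.log u - Real.log v)
    (hG : ∀ u v, G u v = 2 * (ρ + f) * u * v - 2 * (a * (v - b) ^ 2 + c + f) * u ^ 2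
      + (σ ^ 2 - 2 * h) * v ^ 2 + a * (v - b) ^ 2 + c
      - ρ * v / u - f * u / v + f + h + σ ^ 2 / 2) :
    ∃ M₁ M₂ : ℝ, 0 < M₁ ∧ 0 < M₂ ∧ ∀ u v : ℝ, 0 < u → 0 < v →
      G u v < M₁ * V u v + M₂ := by
  have log_le : ∀ x : ℝ, 0 < x → Real.log x ≤ x ^ 2 / 2 := fun x hx => by
    nlinarith [Real.log_le_sub_one_of_pos hx, sq_nonneg (x - 1)]
  refine ⟨2 * (ρ + f + σ ^ 2 + a), a * b ^ 2 + c + f + h + σ ^ 2 / 2 + 1,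
    by positivity, by positivity, fun u v hu hv => ?_⟩
  have hVlow : (u ^ 2 + v ^ 2) / 2 ≤ V u v := by
    rw [hV]
    linarith [log_le u hu, log_le v hv]
  have hMV : 2 * (ρ + f + σ ^ 2 + a) * ((u ^ 2 + v ^ 2) / 2)
      ≤ 2 * (ρ + f + σ ^ 2 + a) * V u v :=
    mul_le_mul_of_nonneg_left hVlow (by positivity)
  have hcross : 0 ≤ (ρ + f) * (u - v) ^ 2 := by positivity
  have hdamp : 0 ≤ 2 * (a * (v - b) ^ 2 + c + f) * u ^ 2 := by positivity
  have hquot₁ : 0 ≤ ρ * v / u := by positivity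
  have hquot₂ : 0 ≤ f * u / v := by positivity
  have hhv : 0 ≤ h * v ^ 2 := by positivity
  have habv : 0 ≤ a * b * v := by positivity
  have hσu : 0 ≤ σ ^ 2 * u ^ 2 := by positivity
  have hau : 0 ≤ a * u ^ 2 := by positivity
  rw [hG]
  linarith
end
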